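/- arXiv:1404.4715 — 2 statements merged into one kernel-verified Lean document; each statement's English description precedes it below -/
import Mathlib

section
/- Let K be a field with an additive valuation v : K → ℝ∞, and let I ⊆ K[x_1,…,x_n] be a weight-homogeneous ideal with respect to weights a_1,…,a_n ∈ ℤ^m. Then for all τ_1, τ_2 ∈ ℝ^m and all w ∈ X^an, μ(τ_1, μ(τ_2, w)) = μ(τ_1 + τ_2, w). Consequently, the set Z := {w ∈ X^an : μ(0,w) = w} equals the image of the map μ : ℝ^m × X^an → X^an, and μ restricts to a continuous action of the additive group ℝ^m on Z. -/
open scoped Classical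

noncomputable section

/-- `ℝ∞ = ℝ ∪ {∞}`, with the order topology. -/
abbrev RInf := WithTop ℝ

noncomputable instance : TopologicalSpace RInf := Preorder.topology RInf
instance : OrderTopology RInf := ⟨rfl⟩

/-- An additive (non-Archimedean) valuation on a commutative ring, with values in
`ℝ∞`: `w(ab) = w(a) + w(b)`, `w(a+b) ≥ min (w a) (w b)`, `w 1 = 0`, `w 0 = ∞`. -/
structure IsVal {R : Type*} [CommRing R] (w : R → RInf) : Prop where
  map_mul : ∀ a b, w (a * b) = w a + w b
  min_le_add : ∀ a b, min (w a) (w b) ≤ w (a + b)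
  map_one : w 1 = 0
  map_zero : w 0 = ⊤

/-- The analytification of `Spec B`: the set of additive valuations on the `K`-algebra
`B` extending the valuation `v` on `K`, as a subset of the product space `B → ℝ∞`
(topology of pointwise convergence). -/
def An {K : Type*} [Field K] (v : K → RInf) (B : Type*) [CommRing B] [Algebra K B] :
    Set (B → RInf) :=
  {w | IsVal w ∧ ∀ c : K, w (algebraMap K B c) = v c}

variable {K : Type*} [Field K] {ι M : Type*} [Fintype M]

/-- Weight of a monomial exponent `α` with respect to weight vectors `a`. -/
def wt (a : ι → M → ℤ) (α : ι →₀ ℕ) : M → ℤ :=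
  α.sum fun i k => (k : ℤ) • a i

/-- The weight-`β` component `F_β` of a polynomial `F`: the sum of the terms `c·x^α`
of `F` with `Σ_i α_i a_i = β`. -/
def wtComp (a : ι → M → ℤ) (F : MvPolynomial ι K) (β : M → ℤ) : MvPolynomial ι K :=
  ∑ α ∈ F.support.filter (fun α => wt a α = β), MvPolynomial.monomial α (F.coeff α)

/-- An ideal is weight-homogeneous if it contains all weight components of its
members. -/
def WtHomog (a : ι → M → ℤ) (I : Ideal (MvPolynomial ι K)) : Prop :=
  ∀ F ∈ I, ∀ β : M → ℤ, wtComp a F β ∈ I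

/-- Pairing `β·τ` of an integer vector with a real vector. -/
def pairR (β : M → ℤ) (τ : M → ℝ) : ℝ := ∑ j, (β j : ℝ) * τ j

/-- `ν(F) = min_β (w(F̄_β) + β·τ)`: the minimum over the finitely many `β` with
`F_β ≠ 0`, with value `∞` for `F = 0`. -/
def muAux (a : ι → M → ℤ) (I : Ideal (MvPolynomial ι K))
    (w : (MvPolynomial ι K ⧸ I) → RInf) (τ : M → ℝ) (F : MvPolynomial ι K) : RInf :=
  (F.support.image (wt a)).inf fun β =>
    w (Ideal.Quotient.mk I (wtComp a F β)) + ((pairR β τ : ℝ) : RInf)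

/-- `μ(τ,w) : B → ℝ∞`, computed on an arbitrary lift of `f` (for weight-homogeneous
`I` this is independent of the lift). -/
def mu (a : ι → M → ℤ) (I : Ideal (MvPolynomial ι K)) (τ : M → ℝ)
    (w : (MvPolynomial ι K ⧸ I) → RInf) : (MvPolynomial ι K ⧸ I) → RInf :=
  fun f => muAux a I w τ (Function.surjInv Ideal.Quotient.mk_surjective f)

/-- The tropicalisation map `X^an → ℝ∞^ι`, `w ↦ (w(x̄_i))_i`. -/
def tropMap (I : Ideal (MvPolynomial ι K)) (w : (MvPolynomial ι K ⧸ I) → RInf) :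
    ι → RInf :=
  fun i => w (Ideal.Quotient.mk I (MvPolynomial.X i))

/-- `Trop(X)`: the image of the analytification under `trop`, inside `ℝ∞^ι`. -/
def TropSet (v : K → RInf) (I : Ideal (MvPolynomial ι K)) : Set (ι → RInf) :=
  {η | ∃ w ∈ An v (MvPolynomial ι K ⧸ I), tropMap I w = η}

/-- `Trop(X⁰)`: the points of `Trop(X)` with all coordinates finite, inside `ℝ^ι`. -/
def TropSet0 (v : K → RInf) (I : Ideal (MvPolynomial ι K)) : Set (ι → ℝ) :=
  {ξ | ∃ w ∈ An v (MvPolynomial ι K ⧸ I), ∀ i, tropMap I w i = ((ξ i : ℝ) : RInf)}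

end

open MvPolynomial

section RInf

theorem continuous_RInf_add_coe : Continuous fun p : RInf × ℝ => p.1 + (p.2 : RInf) := by
  rw [continuous_iff_continuousAt]
  rintro ⟨x, r⟩
  refine tendsto_order.2 ⟨fun c hc => ?_, fun c hc => ?_⟩
  · change c < x + (r : RInf) at hc
    induction c using WithTop.recTopCoe with
    | top => exact absurd hc not_top_lt
    | coe c =>
      have hx : ((c - r : ℝ) : RInf) < x := by
        induction x using WithTop.recTopCoe with
        | top => exact WithTop.coe_lt_top _
        | coe x =>
          norm_cast at hc ⊢
          linarith
      obtain ⟨d, hcd, hdx⟩ : ∃ d : ℝ, c - r < d ∧ (d : RInf) < x := by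
        induction x using WithTop.recTopCoe with
        | top => exact ⟨c - r + 1, by linarith, WithTop.coe_lt_top _⟩
        | coe x =>
          norm_cast at hx
          obtain ⟨d, h₁, h₂⟩ := exists_between hx
          exact ⟨d, h₁, WithTop.coe_lt_coe.2 h₂⟩
      have hr : c - d < r := by linarith
      filter_upwards [prod_mem_nhds (Ioi_mem_nhds hdx) (Ioi_mem_nhds hr)]
      rintro ⟨y, s⟩ ⟨hy, hs⟩
      simp only [Set.mem_Ioi] at hy hs
      change (c : RInf) < y + (s : RInf)
      induction y using WithTop.recTopCoe with
      | top => simp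
      | coe y =>
        norm_cast at hy ⊢
        linarith
  · change x + (r : RInf) < c at hc
    induction x using WithTop.recTopCoe with
    | top => simp at hc
    | coe x =>
      obtain ⟨d, hxd, hdc⟩ : ∃ d : ℝ, x < d ∧ ((d + r : ℝ) : RInf) < c := by
        induction c using WithTop.recTopCoe with
        | top => exact ⟨x + 1, by linarith, WithTop.coe_lt_top _⟩
        | coe c =>
          norm_cast at hc
          obtain ⟨d, h₁, h₂⟩ := exists_between (lt_sub_iff_add_lt.2 hc)
          exact ⟨d, h₁, WithTop.coe_lt_coe.2 (lt_sub_iff_add_lt.1 h₂)⟩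
      obtain ⟨e, hre, hec⟩ : ∃ e : ℝ, r < e ∧ ((d + e : ℝ) : RInf) < c := by
        induction c using WithTop.recTopCoe with
        | top => exact ⟨r + 1, by linarith, WithTop.coe_lt_top _⟩
        | coe c =>
          norm_cast at hdc
          obtain ⟨e, h₁, h₂⟩ := exists_between (lt_sub_iff_add_lt'.2 hdc)
          exact ⟨e, h₁, WithTop.coe_lt_coe.2 (lt_sub_iff_add_lt'.1 h₂)⟩
      filter_upwards [prod_mem_nhds (Iio_mem_nhds (WithTop.coe_lt_coe.2 hxd)) (Iio_mem_nhds hre)]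
      rintro ⟨y, s⟩ ⟨hy, hs⟩
      simp only [Set.mem_Iio] at hy hs
      refine lt_trans ?_ hec
      change y + (s : RInf) < ((d + e : ℝ) : RInf)
      induction y using WithTop.recTopCoe with
      | top => exact absurd hy not_top_lt
      | coe y =>
        norm_cast at hy ⊢
        linarith

theorem eq_and_eq_of_add_le_add {x y p q : RInf} (hx : x ≠ ⊤) (hy : y ≠ ⊤) (hp : x ≤ p)
    (hq : y ≤ q) (h : p + q ≤ x + y) : p = x ∧ q = y := by
  lift x to ℝ using hx
  lift y to ℝ using hy
  induction p using WithTop.recTopCoe with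
  | top => simp [← WithTop.coe_add] at h
  | coe p =>
    induction q using WithTop.recTopCoe with
    | top => simp [← WithTop.coe_add] at h
    | coe q =>
      norm_cast at *
      constructor <;> linarith

theorem add_coe_le_add_coe_iff {x y : RInf} (r : ℝ) : x + (r : RInf) ≤ y + (r : RInf) ↔ x ≤ y := by
  induction x using WithTop.recTopCoe with
  | top => induction y using WithTop.recTopCoe <;> simp [← WithTop.coe_add]
  | coe x =>
    induction y using WithTop.recTopCoe with
    | top => simp
    | coe y =>
      norm_cast
      constructor <;> intro h <;> linarith

end RInf

section pairR

variable {M : Type*} [Fintype M]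

theorem pairR_add_left (β γ : M → ℤ) (τ : M → ℝ) : pairR (β + γ) τ = pairR β τ + pairR γ τ := by
  simp [pairR, add_mul, Finset.sum_add_distrib]

theorem pairR_add_right (β : M → ℤ) (σ τ : M → ℝ) : pairR β (σ + τ) = pairR β σ + pairR β τ := by
  simp [pairR, mul_add, Finset.sum_add_distrib]

theorem pairR_zero_left (τ : M → ℝ) : pairR (0 : M → ℤ) τ = 0 := by
  simp [pairR]

theorem continuous_pairR (β : M → ℤ) : Continuous (pairR β) := by
  unfold pairR
  fun_prop

end pairR

section IsVal

variable {R : Type*} [CommRing R] {w : R → RInf}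

/-- The bundled additive valuation attached to `IsVal`. -/
noncomputable def IsVal.toAddValuation (hw : IsVal w) : AddValuation R RInf :=
  AddValuation.of w hw.map_zero hw.map_one hw.min_le_add hw.map_mul

theorem IsVal.le_sum (hw : IsVal w) {κ : Type*} {s : Finset κ} {f : κ → R} {c : RInf}
    (h : ∀ i ∈ s, c ≤ w (f i)) : c ≤ w (∑ i ∈ s, f i) :=
  hw.toAddValuation.map_le_sum h

theorem IsVal.sum_eq_of_lt (hw : IsVal w) {κ : Type*} {s : Finset κ} {f : κ → R} {k : κ}
    (hk : k ∈ s) (hfin : w (f k) ≠ ⊤) (h : ∀ i ∈ s, i ≠ k → w (f k) < w (f i)) :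
    w (∑ i ∈ s, f i) = w (f k) := by
  classical
  rw [← Finset.add_sum_erase s f hk]
  exact hw.toAddValuation.map_add_eq_of_lt_left
    (hw.toAddValuation.map_lt_sum hfin fun i hi =>
      h i (Finset.mem_of_mem_erase hi) (Finset.ne_of_mem_erase hi))

end IsVal

section wtComp

variable {K : Type*} [Field K] {ι M : Type*}

theorem wt_eq_weight (a : ι → M → ℤ) (α : ι →₀ ℕ) : wt a α = Finsupp.weight a α := by
  simp [wt, Finsupp.weight_apply]

variable [Fintype M]

theorem wtComp_eq (a : ι → M → ℤ) (F : MvPolynomial ι K) (β : M → ℤ) :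
    wtComp a F β = weightedHomogeneousComponent a β F := by
  rw [weightedHomogeneousComponent_apply, wtComp]
  simp only [wt_eq_weight]

theorem wtComp_eq_zero {a : ι → M → ℤ} {F : MvPolynomial ι K} {β : M → ℤ}
    (h : β ∉ F.support.image (wt a)) : wtComp a F β = 0 := by
  rw [wtComp, Finset.filter_eq_empty_iff.2, Finset.sum_empty]
  exact fun α hα hβ => h (Finset.mem_image.2 ⟨α, hα, hβ⟩)

theorem sum_wtComp (a : ι → M → ℤ) (F : MvPolynomial ι K) :
    ∑ β ∈ F.support.image (wt a), wtComp a F β = F := by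
  unfold wtComp
  rw [Finset.sum_fiberwise_of_maps_to fun α hα => Finset.mem_image_of_mem _ hα]
  exact F.support_sum_monomial_coeff

theorem wtComp_of_isWeightedHomogeneous {a : ι → M → ℤ} {F : MvPolynomial ι K} {γ : M → ℤ}
    (hF : IsWeightedHomogeneous a F γ) (β : M → ℤ) :
    wtComp a F β = if γ = β then F else 0 := by
  rw [wtComp_eq]
  split_ifs with h
  · rw [← h, hF.weightedHomogeneousComponent_same]
  · exact hF.weightedHomogeneousComponent_ne β (Ne.symm h)

theorem isWeightedHomogeneous_wtComp (a : ι → M → ℤ) (F : MvPolynomial ι K) (β : M → ℤ) :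
    IsWeightedHomogeneous a (wtComp a F β) β := by
  rw [wtComp_eq]
  exact weightedHomogeneousComponent_isWeightedHomogeneous β F

theorem wtComp_mul (a : ι → M → ℤ) (F G : MvPolynomial ι K) (β : M → ℤ) :
    wtComp a (F * G) β =
      ∑ p ∈ (F.support.image (wt a) ×ˢ G.support.image (wt a)).filter (fun p => p.1 + p.2 = β),
        wtComp a F p.1 * wtComp a G p.2 := by
  conv_lhs => rw [← sum_wtComp a F, ← sum_wtComp a G, Finset.sum_mul_sum, ← Finset.sum_product',
    wtComp_eq, map_sum]
  rw [Finset.sum_filter]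
  refine Finset.sum_congr rfl fun p _ => ?_
  rw [← wtComp_eq, wtComp_of_isWeightedHomogeneous
    ((isWeightedHomogeneous_wtComp a F p.1).mul (isWeightedHomogeneous_wtComp a G p.2))]

end wtComp

section mu

variable {K : Type*} [Field K] {ι M : Type*} [Fintype M] {a : ι → M → ℤ}
  {I : Ideal (MvPolynomial ι K)} {w : (MvPolynomial ι K ⧸ I) → RInf}

theorem le_muAux_iff (hw : w 0 = ⊤) {τ : M → ℝ} {F : MvPolynomial ι K} {c : RInf} :
    c ≤ muAux a I w τ F ↔
      ∀ β, c ≤ w (Ideal.Quotient.mk I (wtComp a F β)) + ((pairR β τ : ℝ) : RInf) := by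
  rw [muAux, Finset.le_inf_iff]
  refine ⟨fun h β => ?_, fun h β _ => h β⟩
  by_cases hβ : β ∈ F.support.image (wt a)
  · exact h β hβ
  · rw [wtComp_eq_zero hβ, map_zero, hw, top_add]
    exact le_top

theorem mu_mk (hI : WtHomog a I) (hw : w 0 = ⊤) (τ : M → ℝ) (F : MvPolynomial ι K) :
    mu a I τ w (Ideal.Quotient.mk I F) = muAux a I w τ F := by
  set G := Function.surjInv Ideal.Quotient.mk_surjective (Ideal.Quotient.mk I F) with hG
  have hGF : Ideal.Quotient.mk I G = Ideal.Quotient.mk I F := Function.surjInv_eq _ _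
  have hcomp (β : M → ℤ) :
      Ideal.Quotient.mk I (wtComp a G β) = Ideal.Quotient.mk I (wtComp a F β) := by
    rw [Ideal.Quotient.eq] at hGF ⊢
    have := hI _ hGF β
    rwa [wtComp_eq, map_sub, ← wtComp_eq, ← wtComp_eq] at this
  change muAux a I w τ G = _
  refine eq_of_forall_le_iff fun c => ?_
  simp only [le_muAux_iff hw, hcomp]

theorem le_mu_mk_iff (hI : WtHomog a I) (hw : w 0 = ⊤) {τ : M → ℝ} {F : MvPolynomial ι K}
    {c : RInf} :
    c ≤ mu a I τ w (Ideal.Quotient.mk I F) ↔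
      ∀ β, c ≤ w (Ideal.Quotient.mk I (wtComp a F β)) + ((pairR β τ : ℝ) : RInf) := by
  rw [mu_mk hI hw, le_muAux_iff hw]

theorem mu_mk_le (hI : WtHomog a I) (hw : w 0 = ⊤) (τ : M → ℝ) (F : MvPolynomial ι K)
    (β : M → ℤ) :
    mu a I τ w (Ideal.Quotient.mk I F) ≤
      w (Ideal.Quotient.mk I (wtComp a F β)) + ((pairR β τ : ℝ) : RInf) :=
  (le_mu_mk_iff hI hw).1 le_rfl β

theorem mu_mk_of_isWeightedHomogeneous (hI : WtHomog a I) (hw : w 0 = ⊤) (τ : M → ℝ)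
    {F : MvPolynomial ι K} {β : M → ℤ} (hF : IsWeightedHomogeneous a F β) :
    mu a I τ w (Ideal.Quotient.mk I F) =
      w (Ideal.Quotient.mk I F) + ((pairR β τ : ℝ) : RInf) := by
  refine eq_of_forall_le_iff fun c => ?_
  simp only [le_mu_mk_iff hI hw, wtComp_of_isWeightedHomogeneous hF]
  refine ⟨fun h => by simpa using h β, fun h γ => ?_⟩
  split_ifs with hγ
  · exact hγ ▸ h
  · simp [hw]

theorem exists_mem_mu_mk_eq (hI : WtHomog a I) (hw : w 0 = ⊤) {τ : M → ℝ}
    {F : MvPolynomial ι K} (h : mu a I τ w (Ideal.Quotient.mk I F) ≠ ⊤) :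
    ∃ β ∈ F.support.image (wt a),
      w (Ideal.Quotient.mk I (wtComp a F β)) + ((pairR β τ : ℝ) : RInf) =
        mu a I τ w (Ideal.Quotient.mk I F) := by
  rw [mu_mk hI hw, muAux] at h ⊢
  have hne : (F.support.image (wt a)).Nonempty := by
    rw [Finset.nonempty_iff_ne_empty]
    rintro h0
    rw [h0, Finset.inf_empty] at h
    exact h rfl
  obtain ⟨β, hβ, heq⟩ := Finset.exists_mem_eq_inf _ hne fun β =>
    w (Ideal.Quotient.mk I (wtComp a F β)) + ((pairR β τ : ℝ) : RInf)
  exact ⟨β, hβ, heq.symm⟩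

theorem IsVal.map_wtComp_mul_add_pairR (hw : IsVal w) (τ : M → ℝ) (F G : MvPolynomial ι K)
    (β γ : M → ℤ) :
    w (Ideal.Quotient.mk I (wtComp a F β * wtComp a G γ)) + ((pairR (β + γ) τ : ℝ) : RInf) =
      (w (Ideal.Quotient.mk I (wtComp a F β)) + ((pairR β τ : ℝ) : RInf)) +
        (w (Ideal.Quotient.mk I (wtComp a G γ)) + ((pairR γ τ : ℝ) : RInf)) := by
  rw [_root_.map_mul, hw.map_mul, pairR_add_left, WithTop.coe_add, add_add_add_comm]

theorem add_le_mu_mk_mul (hI : WtHomog a I) (hw : IsVal w) (τ : M → ℝ)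
    (F G : MvPolynomial ι K) :
    mu a I τ w (Ideal.Quotient.mk I F) + mu a I τ w (Ideal.Quotient.mk I G) ≤
      mu a I τ w (Ideal.Quotient.mk I (F * G)) := by
  refine (le_mu_mk_iff hI hw.map_zero).2 fun β => ?_
  have hcancel (c : RInf) (r : ℝ) : c + ((-r : ℝ) : RInf) + (r : RInf) = c := by
    rw [add_assoc, ← WithTop.coe_add]
    simp
  rw [← hcancel (mu a I τ w (Ideal.Quotient.mk I F) + mu a I τ w (Ideal.Quotient.mk I G))
    (pairR β τ), add_coe_le_add_coe_iff, wtComp_mul, map_sum]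
  refine hw.le_sum fun p hp => ?_
  rw [← add_coe_le_add_coe_iff (pairR β τ), hcancel, ← (Finset.mem_filter.1 hp).2,
    hw.map_wtComp_mul_add_pairR]
  exact add_le_add (mu_mk_le hI hw.map_zero τ F _) (mu_mk_le hI hw.map_zero τ G _)

theorem mu_mk_mul_le_add (hI : WtHomog a I) (hw : IsVal w) (τ : M → ℝ)
    (F G : MvPolynomial ι K) :
    mu a I τ w (Ideal.Quotient.mk I (F * G)) ≤
      mu a I τ w (Ideal.Quotient.mk I F) + mu a I τ w (Ideal.Quotient.mk I G) := by
  by_cases hF : mu a I τ w (Ideal.Quotient.mk I F) = ⊤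
  · simp [hF]
  by_cases hG : mu a I τ w (Ideal.Quotient.mk I G) = ⊤
  · simp [hG]
  obtain ⟨β, hβ, hβF⟩ := exists_mem_mu_mk_eq hI hw.map_zero hF
  obtain ⟨γ, hγ, hγG⟩ := exists_mem_mu_mk_eq hI hw.map_zero hG
  obtain ⟨b, hb, c, hc, huniq⟩ := UniqueSums.uniqueAdd_of_nonempty
    (A := (F.support.image (wt a)).filter fun β =>
      w (Ideal.Quotient.mk I (wtComp a F β)) + ((pairR β τ : ℝ) : RInf) =
        mu a I τ w (Ideal.Quotient.mk I F))
    (B := (G.support.image (wt a)).filter fun β =>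
      w (Ideal.Quotient.mk I (wtComp a G β)) + ((pairR β τ : ℝ) : RInf) =
        mu a I τ w (Ideal.Quotient.mk I G))
    ⟨β, Finset.mem_filter.2 ⟨hβ, hβF⟩⟩ ⟨γ, Finset.mem_filter.2 ⟨hγ, hγG⟩⟩
  rw [Finset.mem_filter] at hb hc
  have hval := hw.map_wtComp_mul_add_pairR (a := a) τ F G b c
  rw [hb.2, hc.2] at hval
  refine (mu_mk_le hI hw.map_zero τ (F * G) (b + c)).trans_eq ?_
  rw [← hval, wtComp_mul, map_sum, hw.sum_eq_of_lt (k := (b, c))]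
  · exact Finset.mem_filter.2 ⟨Finset.mem_product.2 ⟨hb.1, hc.1⟩, rfl⟩
  · intro htop
    rw [htop, top_add] at hval
    exact WithTop.add_ne_top.2 ⟨hF, hG⟩ hval.symm
  · rintro ⟨i, j⟩ hij hne
    obtain ⟨hmem, hsum⟩ := Finset.mem_filter.1 hij
    obtain ⟨hi, hj⟩ := Finset.mem_product.1 hmem
    by_contra! hle
    rw [← add_coe_le_add_coe_iff (pairR (b + c) τ), hval, ← hsum,
      hw.map_wtComp_mul_add_pairR] at hle
    obtain ⟨h₁, h₂⟩ := eq_and_eq_of_add_le_add hF hG (mu_mk_le hI hw.map_zero τ F i)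
      (mu_mk_le hI hw.map_zero τ G j) hle
    obtain ⟨rfl, rfl⟩ := huniq (Finset.mem_filter.2 ⟨hi, h₁⟩) (Finset.mem_filter.2 ⟨hj, h₂⟩) hsum
    exact hne rfl

theorem mu_mk_C (hI : WtHomog a I) (hw : w 0 = ⊤) (τ : M → ℝ) (r : K) :
    mu a I τ w (Ideal.Quotient.mk I (C r)) = w (Ideal.Quotient.mk I (C r)) := by
  rw [mu_mk_of_isWeightedHomogeneous hI hw τ (isWeightedHomogeneous_C a r), pairR_zero_left,
    WithTop.coe_zero, add_zero]

theorem isVal_mu (hI : WtHomog a I) (hw : IsVal w) (τ : M → ℝ) : IsVal (mu a I τ w) where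
  map_mul f g := by
    obtain ⟨F, rfl⟩ := Ideal.Quotient.mk_surjective f
    obtain ⟨G, rfl⟩ := Ideal.Quotient.mk_surjective g
    rw [← map_mul]
    exact le_antisymm (mu_mk_mul_le_add hI hw τ F G) (add_le_mu_mk_mul hI hw τ F G)
  min_le_add f g := by
    obtain ⟨F, rfl⟩ := Ideal.Quotient.mk_surjective f
    obtain ⟨G, rfl⟩ := Ideal.Quotient.mk_surjective g
    rw [← map_add]
    refine (le_mu_mk_iff hI hw.map_zero).2 fun β => ?_
    refine (min_le_min (mu_mk_le hI hw.map_zero τ F β) (mu_mk_le hI hw.map_zero τ G β)).trans ?_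
    rw [min_add_add_right]
    refine add_le_add_left ?_ _
    simp only [wtComp_eq, map_add]
    exact hw.min_le_add _ _
  map_one := by
    have := mu_mk_C hI hw.map_zero τ 1
    rwa [C_1, map_one, hw.map_one] at this
  map_zero := by
    have := mu_mk_C hI hw.map_zero τ 0
    rwa [C_0, map_zero, hw.map_zero] at this

theorem mu_mem_An {v : K → RInf} (hI : WtHomog a I) (hw : w ∈ An v (MvPolynomial ι K ⧸ I))
    (τ : M → ℝ) : mu a I τ w ∈ An v (MvPolynomial ι K ⧸ I) :=
  ⟨isVal_mu hI hw.1 τ, fun r => (mu_mk_C hI hw.1.map_zero τ r).trans (hw.2 r)⟩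

theorem mu_mu (hI : WtHomog a I) (hw : IsVal w) (σ τ : M → ℝ) :
    mu a I σ (mu a I τ w) = mu a I (σ + τ) w := by
  funext f
  obtain ⟨F, rfl⟩ := Ideal.Quotient.mk_surjective f
  refine eq_of_forall_le_iff fun c => ?_
  rw [le_mu_mk_iff hI (isVal_mu hI hw τ).map_zero, le_mu_mk_iff hI hw.map_zero]
  refine forall_congr' fun β => ?_
  rw [mu_mk_of_isWeightedHomogeneous hI hw.map_zero τ (isWeightedHomogeneous_wtComp a F β),
    add_assoc, ← WithTop.coe_add, pairR_add_right, add_comm (pairR β τ)]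

theorem continuous_mu (a : ι → M → ℤ) (I : Ideal (MvPolynomial ι K)) :
    Continuous fun p : (M → ℝ) × ((MvPolynomial ι K ⧸ I) → RInf) => mu a I p.1 p.2 := by
  refine continuous_pi fun f => Continuous.finset_inf_apply fun β _ => ?_
  have hw : Continuous fun p : (M → ℝ) × ((MvPolynomial ι K ⧸ I) → RInf) =>
      p.2 (Ideal.Quotient.mk I
        (wtComp a (Function.surjInv Ideal.Quotient.mk_surjective f) β)) :=
    (continuous_apply _).comp continuous_snd
  exact continuous_RInf_add_coe.comp (hw.prodMk ((continuous_pairR β).comp continuous_fst))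

end mu

/-- `μ(τ₁, μ(τ₂, w)) = μ(τ₁+τ₂, w)`; consequently
`Z = {w ∈ X^an : μ(0,w) = w}` equals the image of `μ : ℝ^m × X^an → X^an`, and `μ`
restricts to a continuous action of the additive group `ℝ^m` on `Z`. -/
theorem mu_cocycle_and_action_on_Z
    {K : Type*} [Field K] (v : K → RInf) (hv : IsVal v)
    {n m : ℕ} (a : Fin n → Fin m → ℤ)
    (I : Ideal (MvPolynomial (Fin n) K)) (hI : WtHomog a I) :
    -- `μ(τ₁, μ(τ₂, w)) = μ(τ₁ + τ₂, w)`
    (∀ (τ₁ τ₂ : Fin m → ℝ) (w : (MvPolynomial (Fin n) K ⧸ I) → RInf),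
      w ∈ An v (MvPolynomial (Fin n) K ⧸ I) →
        mu a I τ₁ (mu a I τ₂ w) = mu a I (τ₁ + τ₂) w) ∧
    -- `Z` equals the image of `μ : ℝ^m × X^an → X^an`
    ({w : (MvPolynomial (Fin n) K ⧸ I) → RInf |
        w ∈ An v (MvPolynomial (Fin n) K ⧸ I) ∧ mu a I 0 w = w} =
      Set.range (fun p :
          (Fin m → ℝ) ×
            {w : (MvPolynomial (Fin n) K ⧸ I) → RInf //
              w ∈ An v (MvPolynomial (Fin n) K ⧸ I)} =>
        mu a I p.1 p.2.val)) ∧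
    -- `μ` maps `ℝ^m × Z` into `Z`
    (∀ (τ : Fin m → ℝ) (w : (MvPolynomial (Fin n) K ⧸ I) → RInf),
      w ∈ An v (MvPolynomial (Fin n) K ⧸ I) → mu a I 0 w = w →
        mu a I τ w ∈ An v (MvPolynomial (Fin n) K ⧸ I) ∧
        mu a I 0 (mu a I τ w) = mu a I τ w) ∧
    -- the action of `ℝ^m` on `Z` is continuous
    Continuous (fun p :
        (Fin m → ℝ) ×
          {w : (MvPolynomial (Fin n) K ⧸ I) → RInf //
            w ∈ An v (MvPolynomial (Fin n) K ⧸ I) ∧ mu a I 0 w = w} =>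
      mu a I p.1 p.2.val) := by
  refine ⟨fun τ₁ τ₂ w hw => mu_mu hI hw.1 τ₁ τ₂, ?_, fun τ w hw _ => ⟨mu_mem_An hI hw τ, ?_⟩, ?_⟩
  · ext w
    constructor
    · rintro ⟨hw, hfix⟩
      exact ⟨(0, ⟨w, hw⟩), hfix⟩
    · rintro ⟨⟨τ, w, hw⟩, rfl⟩
      refine ⟨mu_mem_An hI hw τ, ?_⟩
      simp only [mu_mu hI hw.1, zero_add]
  · rw [mu_mu hI hw.1, zero_add]
  · exact (continuous_mu a I).comp
      (continuous_fst.prodMk (continuous_subtype_val.comp continuous_snd))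
end

section
/- Let K be a field with a surjective additive valuation v : K → ℝ∞, let m ≥ 2, let E := {(i,j) : 1 ≤ i < j ≤ m}, and let I ⊆ K[x_e : e ∈ E] be the kernel of the K-algebra homomorphism K[x_e : e ∈ E] → K[y_1,…,y_m] sending x_{ij} ↦ y_i − y_j, with B := K[x_e]/I and Trop(Y) := {(w(x̄_e))_{e∈E} : w an additive valuation on B extending v}. Then a point η ∈ (ℝ∞)^E lies in Trop(Y) if and only if for all 1 ≤ i < j < k ≤ m, the minimum of the three values η_{ij}, η_{ik}, η_{jk} is attained at least twice (at least two of the three values equal their minimum). -/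
open scoped Classical

/-- The minimum of three values in `ℝ∞` is attained at least twice. -/
def TwiceMin3 (x y z : RInf) : Prop :=
  ∃ p q : Fin 3, p ≠ q ∧
    ![x, y, z] p = min x (min y z) ∧ ![x, y, z] q = min x (min y z)

/-- The index set `E = {(i,j) : 1 ≤ i < j ≤ m}`. -/
abbrev GrVar' (m : ℕ) := {e : Fin m × Fin m // e.1 < e.2}

/-- The ideal of the linear space parameterised by `x_{ij} = y_i − y_j`: the kernel
of the homomorphism `x_{ij} ↦ y_i − y_j`. -/
noncomputable def diffIdeal (K : Type*) [Field K] (m : ℕ) :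
    Ideal (MvPolynomial (GrVar' m) K) :=
  RingHom.ker (MvPolynomial.aeval (fun e : GrVar' m =>
    (MvPolynomial.X e.val.1 - MvPolynomial.X e.val.2 : MvPolynomial (Fin m) K)))

theorem twiceMin3_iff (x y z : RInf) :
    TwiceMin3 x y z ↔ min x y ≤ z ∧ min x z ≤ y ∧ min y z ≤ x := by
  constructor
  · rintro ⟨p, q, hpq, hp, hq⟩
    fin_cases p <;> fin_cases q <;>
      simp only [Fin.zero_eta, Fin.mk_one, Fin.reduceFinMk, Matrix.cons_val, ne_eq,
        not_true_eq_false] at hpq hp hq <;> grind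
  · rintro ⟨h₁, h₂, h₃⟩
    rcases le_total x y with hxy | hxy <;> rcases le_total y z with hyz | hyz <;>
      rcases le_total x z with hxz | hxz
    all_goals first
      | exact ⟨0, 1, by decide, by simp; grind, by simp; grind⟩
      | exact ⟨0, 2, by decide, by simp; grind, by simp; grind⟩
      | exact ⟨1, 2, by decide, by simp; grind, by simp; grind⟩

namespace IsVal

/-- A valuation in the sense of `IsVal`, bundled as Mathlib's `AddValuation`. -/
noncomputable def toAddValuation_s12 {R : Type*} [CommRing R] {w : R → RInf} (hw : IsVal w) :
    AddValuation R RInf :=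
  AddValuation.of w hw.map_zero hw.map_one hw.min_le_add hw.map_mul

@[simp]
theorem toAddValuation_apply {R : Type*} [CommRing R] {w : R → RInf} (hw : IsVal w) (a : R) :
    hw.toAddValuation_s12 a = w a := rfl

theorem map_neg {R : Type*} [CommRing R] {w : R → RInf} (hw : IsVal w) (a : R) :
    w (-a) = w a :=
  hw.toAddValuation_s12.map_neg a

theorem map_sub_swap {R : Type*} [CommRing R] {w : R → RInf} (hw : IsVal w) (a b : R) :
    w (a - b) = w (b - a) := by
  rw [← hw.map_neg, neg_sub]

theorem comp {R S : Type*} [CommRing R] [CommRing S] {w : S → RInf} (hw : IsVal w)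
    (f : R →+* S) : IsVal fun a => w (f a) where
  map_mul a b := by rw [f.map_mul, hw.map_mul]
  min_le_add a b := by rw [f.map_add]; exact hw.min_le_add _ _
  map_one := by rw [f.map_one, hw.map_one]
  map_zero := by rw [f.map_zero, hw.map_zero]

end IsVal

/-- The value of the `k`-th term of a polynomial when the variable has value `r`. -/
noncomputable def gaussTerm {R : Type*} [CommRing R] (w : R → RInf) (r : ℝ) (p : Polynomial R)
    (k : ℕ) : RInf :=
  w (p.coeff k) + ((k * r : ℝ) : RInf)

/-- The Gauss extension of `w` to `R[X]` giving the variable the value `r`. -/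
noncomputable def gaussVal {R : Type*} [CommRing R] (w : R → RInf) (r : ℝ) (p : Polynomial R) :
    RInf :=
  p.support.inf (gaussTerm w r p)

theorem le_gaussVal_iff {R : Type*} [CommRing R] {w : R → RInf} (hw : IsVal w) (r : ℝ)
    (p : Polynomial R) (c : RInf) : c ≤ gaussVal w r p ↔ ∀ k, c ≤ gaussTerm w r p k := by
  rw [gaussVal, Finset.le_inf_iff]
  refine ⟨fun h k => ?_, fun h k _ => h k⟩
  by_cases hk : k ∈ p.support
  · exact h k hk
  · simp [gaussTerm, Polynomial.notMem_support_iff.mp hk, hw.map_zero]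

theorem gaussVal_le_gaussTerm {R : Type*} [CommRing R] {w : R → RInf} (hw : IsVal w) (r : ℝ)
    (p : Polynomial R) (k : ℕ) : gaussVal w r p ≤ gaussTerm w r p k :=
  (le_gaussVal_iff hw r p _).mp le_rfl k

theorem exists_least_gaussTerm {R : Type*} [CommRing R] {w : R → RInf} (hw : IsVal w) (r : ℝ)
    (p : Polynomial R) :
    ∃ k, gaussTerm w r p k = gaussVal w r p ∧ ∀ l < k, gaussVal w r p < gaussTerm w r p l := by
  have hex : ∃ k, gaussTerm w r p k = gaussVal w r p := by
    by_cases hp : p = 0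
    · exact ⟨0, by simp [hp, gaussTerm, gaussVal, hw.map_zero]⟩
    · obtain ⟨k, _, hk⟩ := Finset.exists_mem_eq_inf p.support
        (Polynomial.support_nonempty.mpr hp) (gaussTerm w r p)
      exact ⟨k, hk.symm⟩
  exact ⟨Nat.find hex, Nat.find_spec hex, fun l hl =>
    (gaussVal_le_gaussTerm hw r p l).lt_of_ne' (Nat.find_min hex hl)⟩

theorem gaussTerm_add_gaussTerm {R : Type*} [CommRing R] {w : R → RInf} (hw : IsVal w) (r : ℝ)
    (p q : Polynomial R) (k l : ℕ) :
    w (p.coeff k * q.coeff l) + (((k + l : ℕ) * r : ℝ) : RInf) =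
      gaussTerm w r p k + gaussTerm w r q l := by
  rw [hw.map_mul, gaussTerm, gaussTerm, Nat.cast_add, add_mul, WithTop.coe_add]
  abel

theorem gaussVal_mul {R : Type*} [CommRing R] {w : R → RInf} (hw : IsVal w) (r : ℝ)
    (p q : Polynomial R) : gaussVal w r (p * q) = gaussVal w r p + gaussVal w r q := by
  have hle : gaussVal w r p + gaussVal w r q ≤ gaussVal w r (p * q) := by
    rw [le_gaussVal_iff hw]
    intro n
    obtain ⟨⟨k, l⟩, hkl, hmin⟩ := Finset.exists_min_image (Finset.HasAntidiagonal.antidiagonal n)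
      (fun x => w (p.coeff x.1 * q.coeff x.2)) ⟨(0, n), by simp⟩
    have hsum : w (p.coeff k * q.coeff l) ≤ w ((p * q).coeff n) := by
      rw [Polynomial.coeff_mul]
      exact hw.toAddValuation_s12.map_le_sum hmin
    calc gaussVal w r p + gaussVal w r q
        ≤ gaussTerm w r p k + gaussTerm w r q l :=
          add_le_add (gaussVal_le_gaussTerm hw r p k) (gaussVal_le_gaussTerm hw r q l)
      _ = w (p.coeff k * q.coeff l) + ((n * r : ℝ) : RInf) := by
          rw [← gaussTerm_add_gaussTerm hw, Finset.HasAntidiagonal.mem_antidiagonal.mp hkl]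
      _ ≤ gaussTerm w r (p * q) n := by
          rw [gaussTerm]; gcongr
  refine le_antisymm ?_ hle
  obtain ⟨k, hk, hk'⟩ := exists_least_gaussTerm hw r p
  obtain ⟨l, hl, hl'⟩ := exists_least_gaussTerm hw r q
  by_cases htop : gaussVal w r p + gaussVal w r q = ⊤
  · rw [htop]; exact le_top
  obtain ⟨hp, hq⟩ := WithTop.add_ne_top.mp htop
  have hlead : w ((p * q).coeff (k + l)) = w (p.coeff k * q.coeff l) := by
    have hmem : (k, l) ∈ Finset.HasAntidiagonal.antidiagonal (k + l) :=
      Finset.HasAntidiagonal.mem_antidiagonal.mpr rfl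
    rw [Polynomial.coeff_mul, ← Finset.add_sum_erase _ _ hmem]
    refine hw.toAddValuation_s12.map_add_eq_of_lt_left (hw.toAddValuation_s12.map_lt_sum ?_ ?_)
    · intro h
      apply htop
      rw [← hk, ← hl, ← gaussTerm_add_gaussTerm hw]
      rw [IsVal.toAddValuation_apply] at h
      rw [h, top_add]
    · rintro ⟨i, j⟩ hij
      obtain ⟨hne, hij⟩ := Finset.mem_erase.mp hij
      rw [Finset.HasAntidiagonal.mem_antidiagonal] at hij
      have hlt : gaussTerm w r p k + gaussTerm w r q l < gaussTerm w r p i + gaussTerm w r q j := by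
        rw [hk, hl]
        rcases lt_trichotomy i k with h | h | h
        · exact WithTop.add_lt_add_of_lt_of_le hq (hk' i h) (gaussVal_le_gaussTerm hw r q j)
        · exact absurd (Prod.ext h (by simp at hij ⊢; omega)) hne
        · exact WithTop.add_lt_add_of_le_of_lt hp (gaussVal_le_gaussTerm hw r p i)
            (hl' j (by simp at hij; omega))
      rw [← gaussTerm_add_gaussTerm hw, ← gaussTerm_add_gaussTerm hw, hij] at hlt
      exact lt_of_add_lt_add_right hlt
  calc gaussVal w r (p * q) ≤ gaussTerm w r (p * q) (k + l) := gaussVal_le_gaussTerm hw r _ _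
    _ = gaussVal w r p + gaussVal w r q := by
        rw [gaussTerm, hlead, gaussTerm_add_gaussTerm hw, hk, hl]

theorem gaussVal_C {R : Type*} [CommRing R] {w : R → RInf} (hw : IsVal w) (r : ℝ) (a : R) :
    gaussVal w r (Polynomial.C a) = w a := by
  refine le_antisymm ?_ ?_
  · simpa [gaussTerm] using gaussVal_le_gaussTerm hw r (Polynomial.C a) 0
  · rw [le_gaussVal_iff hw]
    rintro (_ | k)
    · simp [gaussTerm]
    · simp [gaussTerm, Polynomial.coeff_C_succ, hw.map_zero]

theorem gaussVal_X_add_C {R : Type*} [CommRing R] {w : R → RInf} (hw : IsVal w) (r : ℝ) (a : R) :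
    gaussVal w r (Polynomial.X + Polynomial.C a) = min (r : RInf) (w a) := by
  refine le_antisymm (le_min ?_ ?_) ?_
  · exact (gaussVal_le_gaussTerm hw r _ 1).trans_eq (by simp [gaussTerm, hw.map_one])
  · exact (gaussVal_le_gaussTerm hw r _ 0).trans_eq (by simp [gaussTerm])
  · rw [le_gaussVal_iff hw]
    rintro (_ | _ | k)
    · simp [gaussTerm]
    · simp [gaussTerm, hw.map_one]
    · simp [gaussTerm, Polynomial.coeff_X, hw.map_zero]

theorem IsVal.gaussVal {R : Type*} [CommRing R] {w : R → RInf} (hw : IsVal w) (r : ℝ) :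
    IsVal (gaussVal w r) where
  map_mul := gaussVal_mul hw r
  min_le_add p q := by
    rw [le_gaussVal_iff hw]
    intro k
    calc min (_root_.gaussVal w r p) (_root_.gaussVal w r q)
        ≤ min (gaussTerm w r p k) (gaussTerm w r q k) :=
          min_le_min (gaussVal_le_gaussTerm hw r p k) (gaussVal_le_gaussTerm hw r q k)
      _ = min (w (p.coeff k)) (w (q.coeff k)) + ((k * r : ℝ) : RInf) :=
          (min_add_add_right _ _ _)
      _ ≤ gaussTerm w r (p + q) k := by
          rw [gaussTerm, Polynomial.coeff_add]
          gcongr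
          exact hw.min_le_add _ _
  map_one := by rw [← Polynomial.C_1, gaussVal_C hw, hw.map_one]
  map_zero := by simp [_root_.gaussVal]

/-- Every finite ultrametric space (in additive notation) embeds isometrically into a valued
extension ring of a given valued field. -/
theorem exists_extension_of_ultrametric.{u, t} {K : Type u} [Field K] {v : K → RInf} (hv : IsVal v)
    {V : Type t} (d : V → V → RInf) (hself : ∀ i, d i i = ⊤) (hsymm : ∀ i j, d i j = d j i)
    (hd : ∀ i j k, min (d i j) (d j k) ≤ d i k) (s : Finset V) :
    ∃ (L : Type u) (_ : CommRing L) (_ : Algebra K L) (w : L → RInf) (y : V → L),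
      w ∈ An v L ∧ ∀ i ∈ s, ∀ j ∈ s, w (y i - y j) = d i j := by
  induction s using Finset.induction_on with
  | empty => exact ⟨K, inferInstance, inferInstance, v, fun _ => 0, ⟨hv, fun _ => rfl⟩, by simp⟩
  | insert a s ha ih =>
    obtain ⟨L, _, _, w, y, ⟨hw, hwv⟩, hy⟩ := ih
    suffices h : ∃ (L' : Type u) (_ : CommRing L') (_ : Algebra K L') (w' : L' → RInf)
        (y' : V → L') (t : L'), w' ∈ An v L' ∧ (∀ i ∈ s, ∀ j ∈ s, w' (y' i - y' j) = d i j) ∧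
          ∀ j ∈ s, w' (t - y' j) = d a j by
      obtain ⟨L', _, _, w', y', t, hw', hy', ht⟩ := h
      refine ⟨L', inferInstance, inferInstance, w', Function.update y' a t, hw', ?_⟩
      have hne : ∀ i ∈ s, i ≠ a := fun i hi h => ha (h ▸ hi)
      intro i hi j hj
      rw [Finset.mem_insert] at hi hj
      rcases hi with rfl | hi <;> rcases hj with rfl | hj
      · rw [sub_self, hw'.1.map_zero, hself]
      · rw [Function.update_self, Function.update_of_ne (hne j hj), ht j hj]
      · rw [Function.update_self, Function.update_of_ne (hne i hi), hw'.1.map_sub_swap, ht i hi,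
          hsymm]
      · rw [Function.update_of_ne (hne i hi), Function.update_of_ne (hne j hj), hy' i hi j hj]
    rcases s.eq_empty_or_nonempty with rfl | hs
    · exact ⟨L, inferInstance, inferInstance, w, y, 0, ⟨hw, hwv⟩, by simp, by simp⟩
    obtain ⟨b, hb, hmax⟩ := Finset.exists_max_image s (d a) hs
    have hmin : ∀ j ∈ s, min (d a b) (d b j) = d a j := by
      intro j hj
      have h₁ := hd a b j
      have h₂ := hmax j hj
      have h₃ := hd b a j
      rw [hsymm b a] at h₃
      grind
    rcases eq_or_ne (d a b) ⊤ with htop | hfin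
    · refine ⟨L, inferInstance, inferInstance, w, y, y b, ⟨hw, hwv⟩, hy, fun j hj => ?_⟩
      rw [hy b hb j hj, ← hmin j hj, htop, min_eq_right le_top]
    · obtain ⟨r, hr⟩ := WithTop.ne_top_iff_exists.mp hfin
      refine ⟨Polynomial L, inferInstance, inferInstance, gaussVal w r,
        fun i => Polynomial.C (y i), Polynomial.X + Polynomial.C (y b), ⟨hw.gaussVal r, ?_⟩,
        ?_, ?_⟩
      · intro c
        rw [Polynomial.algebraMap_apply, gaussVal_C hw, hwv]
      · intro i hi j hj
        rw [← Polynomial.C_sub, gaussVal_C hw, hy i hi j hj]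
      · intro j hj
        rw [add_sub_assoc, ← Polynomial.C_sub, gaussVal_X_add_C hw, hr, hy b hb j hj, hmin j hj]

/-- Points of the parameter space with values in a valued `K`-algebra give points of the
tropicalisation. -/
theorem mem_tropSet_diffIdeal {K L : Type*} [Field K] [CommRing L] [Algebra K L] {v : K → RInf}
    {m : ℕ} {w : L → RInf} (hw : w ∈ An v L) (y : Fin m → L) :
    (fun e : GrVar' m => w (y e.val.1 - y e.val.2)) ∈ TropSet v (diffIdeal K m) := by
  let f : MvPolynomial (GrVar' m) K →ₐ[K] L :=
    (MvPolynomial.aeval y).comp (MvPolynomial.aeval fun e : GrVar' m =>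
      (MvPolynomial.X e.val.1 - MvPolynomial.X e.val.2 : MvPolynomial (Fin m) K))
  have hf : ∀ p ∈ diffIdeal K m, f p = 0 := fun p hp => by
    have hp' := RingHom.mem_ker.mp hp
    exact (congrArg (MvPolynomial.aeval y) hp').trans (map_zero _)
  let g := Ideal.Quotient.liftₐ (diffIdeal K m) f hf
  refine ⟨fun b => w (g b), ⟨hw.1.comp g.toRingHom, fun c => ?_⟩, ?_⟩
  · exact (congrArg w (g.commutes c)).trans (hw.2 c)
  · funext e
    change w (f (MvPolynomial.X e)) = _
    simp [f]

theorem mk_X_add_mk_X (K : Type*) [Field K] {m : ℕ} {i j k : Fin m} (hij : i < j) (hjk : j < k) :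
    Ideal.Quotient.mk (diffIdeal K m) (MvPolynomial.X ⟨(i, j), hij⟩) +
      Ideal.Quotient.mk (diffIdeal K m) (MvPolynomial.X ⟨(j, k), hjk⟩) =
      Ideal.Quotient.mk (diffIdeal K m) (MvPolynomial.X ⟨(i, k), hij.trans hjk⟩) := by
  rw [← map_add, Ideal.Quotient.eq, diffIdeal, RingHom.mem_ker]
  simp

/-- The symmetric extension of `η` to all pairs, with value `∞` on the diagonal. -/
noncomputable def symmExt {m : ℕ} (η : GrVar' m → RInf) (i j : Fin m) : RInf :=
  if h : i < j then η ⟨(i, j), h⟩ else if h : j < i then η ⟨(j, i), h⟩ else ⊤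

theorem symmExt_of_lt {m : ℕ} (η : GrVar' m → RInf) {i j : Fin m} (h : i < j) :
    symmExt η i j = η ⟨(i, j), h⟩ := by
  simp [symmExt, h]

theorem symmExt_self {m : ℕ} (η : GrVar' m → RInf) (i : Fin m) : symmExt η i i = ⊤ := by
  simp [symmExt]

theorem symmExt_comm {m : ℕ} (η : GrVar' m → RInf) (i j : Fin m) :
    symmExt η i j = symmExt η j i := by
  rcases lt_trichotomy i j with h | rfl | h
  · simp [symmExt, h, h.not_gt]
  · rfl
  · simp [symmExt, h, h.not_gt]

theorem min_symmExt_le {m : ℕ} {η : GrVar' m → RInf}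
    (hη : ∀ i j k : Fin m, ∀ (hij : i < j) (hjk : j < k),
      TwiceMin3 (η ⟨(i, j), hij⟩) (η ⟨(i, k), hij.trans hjk⟩) (η ⟨(j, k), hjk⟩))
    (i j k : Fin m) : min (symmExt η i j) (symmExt η j k) ≤ symmExt η i k := by
  have key : ∀ a b c : Fin m, a < b → b < c →
      min (symmExt η a b) (symmExt η a c) ≤ symmExt η b c ∧
      min (symmExt η a b) (symmExt η b c) ≤ symmExt η a c ∧
      min (symmExt η a c) (symmExt η b c) ≤ symmExt η a b := fun a b c hab hbc => by
    rw [symmExt_of_lt η hab, symmExt_of_lt η hbc, symmExt_of_lt η (hab.trans hbc)]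
    exact (twiceMin3_iff _ _ _).mp (hη a b c hab hbc)
  have hs := symmExt_comm η
  have hd := symmExt_self η
  rcases lt_trichotomy i j with hij | rfl | hij
  · rcases lt_trichotomy j k with hjk | rfl | hjk
    · exact (key i j k hij hjk).2.1
    · exact min_le_left _ _
    · rcases lt_trichotomy i k with hik | rfl | hik
      · rw [hs j k]; exact (key i k j hik hjk).2.2
      · rw [hd]; exact le_top
      · rw [hs j k, hs i k]
        have := key k i j hik hij
        grind
  · exact min_le_right _ _
  · rcases lt_trichotomy j k with hjk | rfl | hjk
    · rcases lt_trichotomy i k with hik | rfl | hik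
      · rw [hs i j]; exact (key j i k hij hik).1
      · rw [hd]; exact le_top
      · rw [hs i j, hs i k]
        have := key j k i hjk hik
        grind
    · exact min_le_left _ _
    · rw [hs i j, hs j k, hs i k, min_comm]; exact (key k j i hjk hij).2.1

/-- A point `η ∈ ℝ∞^E` lies in the tropicalisation of the linear
space `{x_{ij} = y_i − y_j}` if and only if for all `i < j < k`, the minimum of
`η_{ij}, η_{ik}, η_{jk}` is attained at least twice. -/
theorem trop_of_difference_linear_space
    {K : Type*} [Field K] (v : K → RInf) (hv : IsVal v)
    (hsurj : Function.Surjective v) (m : ℕ) (hm : 2 ≤ m)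
    (η : GrVar' m → RInf) :
    η ∈ TropSet v (diffIdeal K m) ↔
      ∀ i j k : Fin m, ∀ (hij : i < j) (hjk : j < k),
        TwiceMin3 (η ⟨(i, j), hij⟩) (η ⟨(i, k), hij.trans hjk⟩) (η ⟨(j, k), hjk⟩) := by
  constructor
  · rintro ⟨w, ⟨hw, -⟩, rfl⟩ i j k hij hjk
    have hadd := mk_X_add_mk_X K hij hjk
    rw [twiceMin3_iff]
    simp only [tropMap]
    generalize Ideal.Quotient.mk (diffIdeal K m) (MvPolynomial.X ⟨(i, j), hij⟩) = a at hadd ⊢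
    generalize Ideal.Quotient.mk (diffIdeal K m) (MvPolynomial.X ⟨(j, k), hjk⟩) = c at hadd ⊢
    rw [← hadd]
    refine ⟨?_, hw.min_le_add a c, ?_⟩
    · simpa [hw.map_neg] using hw.min_le_add (-a) (a + c)
    · simpa [hw.map_neg] using hw.min_le_add (a + c) (-c)
  · intro hη
    obtain ⟨L, _, _, w, y, hw, hy⟩ := exists_extension_of_ultrametric hv (symmExt η)
      (symmExt_self η) (symmExt_comm η) (min_symmExt_le hη) Finset.univ
    convert mem_tropSet_diffIdeal hw y using 1
    funext e
    rw [hy _ (Finset.mem_univ _) _ (Finset.mem_univ _), symmExt_of_lt η e.2]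
end
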